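/- arXiv:1704.08228 — 4 statements merged into one kernel-verified Lean document; each statement's English description precedes it below -/
import Mathlib

section
/- Let α > 0 and m = 2α. Then the function f(x) = x^{−α−1} e^{−1/x} / Γ(α) on (0,∞) is the unique density solution to the equation x^{2α} f(x) = (1/Γ(α)) ∫_0^x (x−v)^{α−1} f(v) dv; in particular it is a probability density on (0,∞) satisfying this equation for every x > 0. (This is the density of the inverse Γ_α^{−1} of a Gamma random variable of parameter α.) -/
open MeasureTheory Real Set Filter

noncomputable section

/-- `f` is a density solution to the integro-differential equation
`I^α_{0+} f = x^m f` on `(0,∞)`: `f` is measurable, nonnegative on `(0,∞)`,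
integrates to `1` on `(0,∞)`, and satisfies
`x^m f(x) = (1/Γ(α)) ∫_0^x (x−v)^{α−1} f(v) dv` for every `x > 0`. -/
def IsDensitySolution (α m : ℝ) (f : ℝ → ℝ) : Prop :=
  Measurable f ∧ (∀ x ∈ Set.Ioi (0:ℝ), 0 ≤ f x) ∧
  (∫ x in Set.Ioi (0:ℝ), f x) = 1 ∧
  ∀ x ∈ Set.Ioi (0:ℝ),
    x ^ m * f x = (1 / Real.Gamma α) * ∫ v in Set.Ioo (0:ℝ) x, (x - v) ^ (α - 1) * f v

theorem ConvexOn.sub_le_mul_of_slope_le {f : ℝ → ℝ} {s : Set ℝ} (hf : ConvexOn ℝ s f)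
    {x t h C : ℝ} (ht : 0 ≤ t) (hh : 0 < h) (hx : x ∈ s) (hxt : x + t + h ∈ s)
    (hC : f (x + t + h) - f (x + t) ≤ h * C) : f (x + t) - f x ≤ t * C := by
  rcases ht.eq_or_lt with rfl | ht
  · simp
  have := hf.slope_mono_adjacent hx hxt (y := x + t) (by linarith) (by linarith)
  rw [add_sub_cancel_left, add_sub_cancel_left, div_le_iff₀ ht] at this
  refine this.trans ?_
  rw [mul_comm t]
  gcongr
  rwa [div_le_iff₀ hh, mul_comm]

theorem ConvexOn.mul_le_sub_of_le_slope {f : ℝ → ℝ} {s : Set ℝ} (hf : ConvexOn ℝ s f)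
    {x t h C : ℝ} (ht : 0 ≤ t) (hh : 0 < h) (hx : x ∈ s) (hxt : x + h + t ∈ s)
    (hC : h * C ≤ f (x + h) - f x) : t * C ≤ f (x + h + t) - f (x + h) := by
  rcases ht.eq_or_lt with rfl | ht
  · simp
  have := hf.slope_mono_adjacent hx hxt (y := x + h) (by linarith) (by linarith)
  rw [add_sub_cancel_left, add_sub_cancel_left, le_div_iff₀ ht] at this
  refine le_trans ?_ this
  rw [mul_comm t]
  gcongr
  rwa [le_div_iff₀ hh, mul_comm]

theorem Real.log_Gamma_add_one_sub {x : ℝ} (hx : 0 < x) :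
    log (Gamma (x + 1)) - log (Gamma x) = log x := by
  rw [Gamma_add_one hx.ne', log_mul hx.ne' (Gamma_pos_of_pos hx).ne']
  ring

theorem Real.log_Gamma_add_sub_le {x t : ℝ} (hx : 0 < x) (ht : 0 ≤ t) :
    log (Gamma (x + t)) - log (Gamma x) ≤ t * log (x + t) :=
  convexOn_log_Gamma.sub_le_mul_of_slope_le ht one_pos (mem_Ioi.2 hx)
    (mem_Ioi.2 (by linarith)) (by
      simpa using (log_Gamma_add_one_sub (x := x + t) (by linarith)).le)

theorem Real.mul_log_le_log_Gamma_add_sub {x t : ℝ} (hx : 1 < x) (ht : 0 ≤ t) :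
    t * log (x - 1) ≤ log (Gamma (x + t)) - log (Gamma x) := by
  have := convexOn_log_Gamma.mul_le_sub_of_le_slope (x := x - 1) (C := log (x - 1)) ht one_pos
    (mem_Ioi.2 (by linarith)) (mem_Ioi.2 (by linarith)) (by
      simpa using (log_Gamma_add_one_sub (x := x - 1) (by linarith)).ge)
  simpa using this

/-- A Bohr–Mollerup type theorem with step `α`. -/
theorem Real.sub_eq_log_Gamma_sub_of_convexOn {α : ℝ} (hα : 0 < α) {ψ : ℝ → ℝ}
    (hψ : ConvexOn ℝ (Ici 0) ψ)
    (hrec : ∀ s, 0 ≤ s →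
      ψ (s + α) - ψ s = log (Gamma (s + α + α)) - log (Gamma (s + α)))
    {t : ℝ} (ht : 0 ≤ t) :
    ψ t - ψ 0 = log (Gamma (t + α)) - log (Gamma α) := by
  set q : ℝ → ℝ := fun s => ψ s - log (Gamma (s + α)) with hq
  have hper : ∀ s, 0 ≤ s → ∀ n : ℕ, q (s + n * α) = q s := by
    intro s hs n
    induction n with
    | zero => simp
    | succ n ih =>
      have h := hrec (s + n * α) (by positivity)
      rw [← ih]
      simp only [hq]
      rw [show s + ((n + 1 : ℕ) : ℝ) * α = s + n * α + α by push_cast; ring]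
      linarith
  have hbound : ∀ n : ℕ, 1 < n * α → |q t - q 0| ≤
      t * (log ((n * α - 1) + (1 + t + 2 * α)) - log (n * α - 1)) := by
    intro n hn
    rw [← hper t ht n, ← hper 0 le_rfl n]
    have hnpos : 0 < (n : ℝ) := by
      by_contra h
      have : (n : ℝ) = 0 := le_antisymm (not_lt.1 h) (Nat.cast_nonneg n)
      rw [this] at hn
      linarith
    have hn1 : (1 : ℝ) ≤ n := by exact_mod_cast (Nat.cast_pos.1 hnpos : 0 < n)
    have hnα : α ≤ n * α := by nlinarith
    have u1 := log_Gamma_add_sub_le (x := n * α + α) (t := t) (by positivity) ht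
    have u2 := mul_log_le_log_Gamma_add_sub (x := n * α + α) (t := t) (by linarith) ht
    have u3 : ψ (n * α + t) - ψ (n * α) ≤ t * log (n * α + t + α + α) := by
      refine hψ.sub_le_mul_of_slope_le ht hα (mem_Ici.2 (by positivity))
        (mem_Ici.2 (by positivity)) ?_
      rw [hrec _ (by positivity)]
      exact log_Gamma_add_sub_le (by positivity) hα.le
    have u4 : t * log (n * α - 1) ≤ ψ (n * α + t) - ψ (n * α) := by
      have := hψ.mul_le_sub_of_le_slope (x := n * α - α) (C := log (n * α - 1)) ht hα
        (mem_Ici.2 (by linarith)) (mem_Ici.2 (by linarith)) (by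
          rw [hrec _ (by linarith)]
          simpa using mul_log_le_log_Gamma_add_sub hn hα.le)
      simpa using this
    have w1 : t * log (n * α + α + t) ≤ t * log (n * α - 1 + (1 + t + 2 * α)) :=
      mul_le_mul_of_nonneg_left (Real.log_le_log (by positivity) (by linarith)) ht
    have w2 : t * log (n * α - 1) ≤ t * log (n * α + α - 1) :=
      mul_le_mul_of_nonneg_left (Real.log_le_log (by linarith) (by linarith)) ht
    rw [show n * α + t + α + α = n * α - 1 + (1 + t + 2 * α) by ring] at u3
    simp only [hq]
    rw [abs_le, show t + n * α = n * α + t by ring, show 0 + n * α = n * α by ring,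
      show n * α + t + α = n * α + α + t by ring, mul_sub]
    constructor <;> linarith
  have hlim : Tendsto (fun n : ℕ => (n : ℝ) * α - 1) atTop atTop :=
    tendsto_atTop_add_const_right _ _ (tendsto_natCast_atTop_atTop.atTop_mul_const hα)
  have hlim' := ((tendsto_log_comp_add_sub_log (1 + t + 2 * α)).comp hlim).const_mul t
  rw [mul_zero] at hlim'
  have hle : |q t - q 0| ≤ 0 := by
    refine ge_of_tendsto hlim' ?_
    filter_upwards [hlim.eventually_gt_atTop 0] with n hn
    exact hbound n (by linarith)
  have h0 : q t - q 0 = 0 := abs_nonpos_iff.1 hle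
  simp only [hq, zero_add] at h0
  linarith

open ProbabilityTheory in
theorem MeasureTheory.Measure.map_eq_of_mgf_eqOn {Ω Ω' : Type*} {mΩ : MeasurableSpace Ω}
    {mΩ' : MeasurableSpace Ω'} {μ : Measure Ω} {μ' : Measure Ω'} [IsFiniteMeasure μ]
    [IsFiniteMeasure μ'] {X : Ω → ℝ} {Y : Ω' → ℝ} (hX : AEMeasurable X μ)
    (hY : AEMeasurable Y μ') {a b : ℝ} (ha : a < 0) (hb : 0 < b)
    (hXi : Ioo a b ⊆ integrableExpSet X μ) (hYi : Ioo a b ⊆ integrableExpSet Y μ')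
    (h : EqOn (mgf X μ) (mgf Y μ') (Ioo a b)) :
    μ.map X = μ'.map Y := by
  have hsX := isOpen_Ioo.subset_interior_iff.2 hXi
  have hsY := isOpen_Ioo.subset_interior_iff.2 hYi
  have hEq : EqOn (complexMGF X μ) (complexMGF Y μ') {z | z.re ∈ Ioo a b} := by
    refine AnalyticOnNhd.eqOn_of_preconnected_of_frequently_eq
      (fun z hz => analyticAt_complexMGF (hsX hz)) (fun z hz => analyticAt_complexMGF (hsY hz))
      ((convex_Ioo a b).linear_preimage Complex.reLm).isPreconnected
      (z₀ := ((0 : ℝ) : ℂ)) (by simp [ha, hb]) ?_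
    have h_real : ∃ᶠ x : ℝ in nhdsWithin 0 {0}ᶜ,
        complexMGF X μ x = complexMGF Y μ' x := by
      refine Eventually.frequently ?_
      filter_upwards [mem_nhdsWithin_of_mem_nhds (Ioo_mem_nhds ha hb)] with x hx
      rw [complexMGF_ofReal, complexMGF_ofReal, h hx]
    have ht : Tendsto (fun x : ℝ => (x : ℂ)) (nhdsWithin 0 {0}ᶜ)
        (nhdsWithin ((0 : ℝ) : ℂ) {((0 : ℝ) : ℂ)}ᶜ) := by
      refine tendsto_nhdsWithin_iff.2 ⟨?_, ?_⟩
      · exact (Complex.continuous_ofReal.tendsto 0).mono_left nhdsWithin_le_nhds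
      · filter_upwards [self_mem_nhdsWithin] with x hx
        simpa using hx
    exact ht.frequently h_real
  refine Measure.ext_of_charFun ?_
  funext t
  rw [← complexMGF_mul_I hX, ← complexMGF_mul_I hY]
  exact hEq (by simp [ha, hb])

theorem integral_comp_inv_sub_inv {x : ℝ} (hx : 0 < x) (g : ℝ → ℝ) :
    ∫ v in Ioo 0 x, v ^ (-2 : ℝ) * g (v⁻¹ - x⁻¹) = ∫ w in Ioi 0, g w := by
  have himg : (fun v : ℝ => v⁻¹ - x⁻¹) '' Ioo 0 x = Ioi 0 := by
    ext w
    simp only [mem_image, mem_Ioo, mem_Ioi]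
    constructor
    · rintro ⟨v, ⟨hv, hvx⟩, rfl⟩
      exact sub_pos.2 (inv_strictAnti₀ hv hvx)
    · intro hw
      have hxi : 0 < x⁻¹ := inv_pos.2 hx
      refine ⟨(w + x⁻¹)⁻¹, ⟨by positivity, ?_⟩, by simp⟩
      exact inv_lt_of_inv_lt₀ hx (by linarith)
  rw [← himg, integral_image_eq_integral_abs_deriv_smul (f' := fun v => -(v ^ 2)⁻¹)
    measurableSet_Ioo]
  · refine setIntegral_congr_fun measurableSet_Ioo fun v hv => ?_
    have hv0 : 0 < v := hv.1
    simp [Real.rpow_neg hv0.le]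
  · intro v hv
    exact ((hasDerivAt_inv hv.1.ne').sub_const _).hasDerivWithinAt
  · intro a _ b _ hab
    simpa using hab

theorem integral_rpow_mul_exp_neg_one_div {α : ℝ} (hα : 0 < α) :
    ∫ x in Ioi (0 : ℝ), x ^ (-α - 1) * exp (-1 / x) = Gamma α := by
  have h := integral_comp_rpow_Ioi (fun y : ℝ => exp (-y) * y ^ (α - 1)) (p := -1) (by norm_num)
  rw [Gamma_eq_integral hα, ← h]
  refine setIntegral_congr_fun measurableSet_Ioi fun x hx => ?_
  have hx : 0 < x := hx
  simp only [smul_eq_mul, abs_neg, abs_one, one_mul, ← rpow_mul hx.le]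
  rw [rpow_neg_one, mul_left_comm, ← rpow_add hx, mul_comm, neg_div, one_div]
  congr 2
  ring

theorem isDensitySolution_inv_gamma {α : ℝ} (hα : 0 < α) :
    IsDensitySolution α (2 * α) (fun x => x ^ (-α - 1) * exp (-1 / x) / Gamma α) := by
  have hΓ := Gamma_pos_of_pos hα
  refine ⟨by fun_prop, fun x hx => ?_, ?_, fun x hx => ?_⟩
  · have hx : 0 < x := hx
    positivity
  · rw [integral_div, integral_rpow_mul_exp_neg_one_div hα, div_self hΓ.ne']
  · have hx : 0 < x := hx
    have hint : ∫ v in Ioo 0 x, (x - v) ^ (α - 1) * (v ^ (-α - 1) * exp (-1 / v) / Gamma α) =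
        x ^ (α - 1) * exp (-1 / x) := by
      have h := integral_comp_inv_sub_inv hx
        (fun w => x ^ (α - 1) * exp (-1 / x) / Gamma α * (exp (-w) * w ^ (α - 1)))
      rw [integral_const_mul, ← Gamma_eq_integral hα, div_mul_cancel₀ _ hΓ.ne'] at h
      rw [← h]
      refine setIntegral_congr_fun measurableSet_Ioo fun v hv => ?_
      have hv0 : 0 < v := hv.1
      have hvx : 0 < x - v := sub_pos.2 hv.2
      have e1 : v⁻¹ - x⁻¹ = (x - v) * (x⁻¹ * v⁻¹) := by field_simp
      have e2 : exp (-1 / v) = exp (-1 / x) * exp (-(v⁻¹ - x⁻¹)) := by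
        rw [← exp_add]
        congr 1
        field_simp
        ring
      have e3 : (v⁻¹ - x⁻¹) ^ (α - 1) =
          (x - v) ^ (α - 1) * ((x ^ (α - 1))⁻¹ * v ^ (1 - α)) := by
        rw [e1, mul_rpow hvx.le (by positivity), mul_rpow (by positivity) (by positivity),
          inv_rpow hx.le, inv_rpow hv0.le, ← rpow_neg hv0.le (α - 1), neg_sub]
      have e4 : v ^ (-α - 1) = v ^ (-2 : ℝ) * v ^ (1 - α) := by
        rw [← rpow_add hv0]
        congr 1
        ring
      have := (rpow_pos_of_pos hx (α - 1)).ne'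
      simp only [e2, e3, e4]
      field_simp
    simp only
    rw [hint, mul_div_assoc', ← mul_assoc, ← rpow_add hx, one_div_mul_eq_div]
    congr 3
    ring

theorem ProbabilityTheory.lintegral_rpow_mul_one_sub_rpow {a b : ℝ} (ha : 0 < a) (hb : 0 < b) :
    ∫⁻ u in Ioo (0 : ℝ) 1, ENNReal.ofReal (u ^ (a - 1) * (1 - u) ^ (b - 1)) =
      ENNReal.ofReal (beta a b) := by
  have hB := beta_pos ha hb
  have h := lintegral_betaPDF_eq_one ha hb
  simp_rw [lintegral_betaPDF, mul_assoc, ENNReal.ofReal_mul (one_div_pos.2 hB).le] at h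
  rw [lintegral_const_mul _ (by fun_prop)] at h
  have h2 : ENNReal.ofReal (beta a b) * ENNReal.ofReal (1 / beta a b) = 1 := by
    rw [← ENNReal.ofReal_mul hB.le, mul_one_div_cancel hB.ne', ENNReal.ofReal_one]
  rw [← one_mul (∫⁻ _ in _, _), ← h2, mul_assoc, h, mul_one]

theorem lintegral_Ioi_sub_rpow_mul_rpow {α s v : ℝ} (hα : 0 < α) (hs : 0 < s + α) (hv : 0 < v) :
    ∫⁻ x in Ioi v, ENNReal.ofReal ((x - v) ^ (α - 1) * x ^ (-s - 2 * α)) =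
      ENNReal.ofReal (v ^ (-(s + α))) *
        ENNReal.ofReal (ProbabilityTheory.beta (s + α) α) := by
  have himg : (fun u : ℝ => v * u⁻¹) '' Ioo 0 1 = Ioi v := by
    ext x
    simp only [mem_image, mem_Ioo, mem_Ioi]
    constructor
    · rintro ⟨u, ⟨hu, hu1⟩, rfl⟩
      have := (one_lt_inv₀ hu).2 hu1
      nlinarith
    · intro hx
      have hx0 := hv.trans hx
      exact ⟨v / x, ⟨by positivity, (div_lt_one hx0).2 hx⟩, by field_simp⟩
  rw [← ProbabilityTheory.lintegral_rpow_mul_one_sub_rpow hs hα,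
    ← lintegral_const_mul _ (by fun_prop), ← himg,
    lintegral_image_eq_lintegral_abs_deriv_mul (f' := fun u => v * -(u ^ 2)⁻¹) measurableSet_Ioo]
  · refine setLIntegral_congr_fun measurableSet_Ioo fun u hu => ?_
    have hu0 : 0 < u := hu.1
    have hu1 : 0 < 1 - u := sub_pos.2 hu.2
    rw [← ENNReal.ofReal_mul (abs_nonneg _), ← ENNReal.ofReal_mul (by positivity)]
    congr 1
    have e0 : |v * -(u ^ 2)⁻¹| = v * u ^ (-2 : ℝ) := by
      rw [mul_neg, abs_neg, abs_of_pos (by positivity), rpow_neg hu0.le, rpow_ofNat]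
    have e1 : v * u⁻¹ - v = v * (u⁻¹ * (1 - u)) := by field_simp
    have e2 : (v * u⁻¹ - v) ^ (α - 1) = v ^ (α - 1) * (u ^ (1 - α) * (1 - u) ^ (α - 1)) := by
      rw [e1, mul_rpow hv.le (by positivity), mul_rpow (by positivity) hu1.le, inv_rpow hu0.le,
        ← rpow_neg hu0.le, neg_sub]
    have e3 : (v * u⁻¹) ^ (-s - 2 * α) = v ^ (-s - 2 * α) * u ^ (s + 2 * α) := by
      rw [mul_rpow hv.le (by positivity), inv_rpow hu0.le, ← rpow_neg hu0.le]
      congr 2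
      ring
    have e4 : v ^ (-(s + α)) = v * v ^ (α - 1) * v ^ (-s - 2 * α) := by
      nth_rewrite 2 [← rpow_one v]
      rw [← rpow_add hv, ← rpow_add hv]
      congr 1
      ring
    have e5 : u ^ (s + α - 1) = u ^ (-2 : ℝ) * u ^ (1 - α) * u ^ (s + 2 * α) := by
      rw [← rpow_add hu0, ← rpow_add hu0]
      congr 1
      ring
    rw [e0, e2, e3, e4, e5]
    ring
  · intro u hu
    exact ((hasDerivAt_inv hu.1.ne').const_mul v).hasDerivWithinAt
  · intro a _ b _ hab
    simpa [hv.ne'] using hab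

/-- The moment of order `-s` of the measure on `(0, ∞)` with density `f`. -/
def negMoment (f : ℝ → ℝ) (s : ℝ) : ENNReal :=
  ∫⁻ x in Ioi (0 : ℝ), ENNReal.ofReal (x ^ (-s)) * ENNReal.ofReal (f x)

theorem ae_integrableOn_sub_rpow_mul {α : ℝ} (hα : 0 < α) {f : ℝ → ℝ}
    (hf : IntegrableOn f (Ioi 0)) :
    ∀ᵐ x : ℝ, IntegrableOn (fun v => (x - v) ^ (α - 1) * f v) (Ioo 0 x) := by
  have h1 : Integrable (indicator (Ioi 0) fun v => exp (-v) * f v) := by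
    rw [integrable_indicator_iff measurableSet_Ioi]
    refine hf.bdd_mul (c := 1) (by fun_prop) ?_
    filter_upwards [ae_restrict_mem measurableSet_Ioi] with v hv
    simpa using (le_of_lt hv : (0 : ℝ) ≤ v)
  have h2 : Integrable (indicator (Ioi 0) fun w : ℝ => exp (-w) * w ^ (α - 1)) :=
    (integrable_indicator_iff measurableSet_Ioi).2 (GammaIntegral_convergent hα)
  filter_upwards [h1.ae_convolution_exists (ContinuousLinearMap.mul ℝ ℝ) h2] with x hx
  have h3 := (Integrable.const_mul hx (exp x)).integrableOn (s := Ioo 0 x)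
  refine h3.congr_fun (fun v hv => ?_) measurableSet_Ioo
  have hv0 : v ∈ Ioi (0 : ℝ) := hv.1
  have hxv : x - v ∈ Ioi (0 : ℝ) := sub_pos.2 hv.2
  simp only [ContinuousLinearMap.mul_apply', indicator_of_mem hv0, indicator_of_mem hxv]
  have : exp x * (exp (-v) * exp (-(x - v))) = 1 := by
    rw [← exp_add, ← exp_add, exp_eq_one_iff]
    ring
  linear_combination ((x - v) ^ (α - 1) * f v) * this

namespace IsDensitySolution

variable {α m : ℝ} {f g : ℝ → ℝ}

theorem integrableOn (hf : IsDensitySolution α m f) : IntegrableOn f (Ioi 0) := by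
  by_contra h
  have := hf.2.2.1
  rw [integral_undef h] at this
  exact zero_ne_one this

theorem negMoment_zero (hf : IsDensitySolution α m f) : negMoment f 0 = 1 := by
  have h := ofReal_integral_eq_lintegral_ofReal hf.integrableOn
    ((ae_restrict_iff' measurableSet_Ioi).2 (ae_of_all _ hf.2.1))
  rw [hf.2.2.1] at h
  simpa [negMoment] using h.symm

theorem ofReal_rpow_mul (hα : 0 < α) (hf : IsDensitySolution α m f) :
    ∀ᵐ x : ℝ ∂volume.restrict (Ioi 0), ENNReal.ofReal (x ^ m) * ENNReal.ofReal (f x) =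
      ENNReal.ofReal (1 / Gamma α) *
        ∫⁻ v in Ioo 0 x, ENNReal.ofReal ((x - v) ^ (α - 1)) * ENNReal.ofReal (f v) := by
  have hΓ := Gamma_pos_of_pos hα
  filter_upwards [ae_restrict_mem measurableSet_Ioi,
    ae_restrict_of_ae (ae_integrableOn_sub_rpow_mul hα hf.integrableOn)] with x hx hint
  have hx0 : 0 < x := hx
  rw [← ENNReal.ofReal_mul (by positivity), hf.2.2.2 x hx, ENNReal.ofReal_mul (by positivity),
    ofReal_integral_eq_lintegral_ofReal hint]
  · congr 1
    refine setLIntegral_congr_fun measurableSet_Ioo fun v hv => ?_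
    exact ENNReal.ofReal_mul (rpow_nonneg (sub_pos.2 hv.2).le _)
  · filter_upwards [ae_restrict_mem measurableSet_Ioo] with v hv
    exact mul_nonneg (rpow_nonneg (sub_pos.2 hv.2).le _) (hf.2.1 v hv.1)

theorem negMoment_eq (hα : 0 < α) (hf : IsDensitySolution α (2 * α) f) {s : ℝ}
    (hs : 0 < s + α) :
    negMoment f s =
      ENNReal.ofReal (Gamma (s + α) / Gamma (s + α + α)) * negMoment f (s + α) := by
  have hΓ := Gamma_pos_of_pos hα
  have hmeas : Measurable f := hf.1
  let F : ℝ → ℝ → ENNReal := fun x v => indicator {p : ℝ × ℝ | p.2 < p.1} (fun p =>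
    ENNReal.ofReal ((p.1 - p.2) ^ (α - 1) * p.1 ^ (-s - 2 * α)) * ENNReal.ofReal (f p.2)) (x, v)
  have hF : Measurable (Function.uncurry F) := by
    refine Measurable.indicator ?_ (measurableSet_lt measurable_snd measurable_fst)
    fun_prop
  calc negMoment f s
      = ∫⁻ x in Ioi 0, ENNReal.ofReal (1 / Gamma α) * ∫⁻ v in Ioi 0, F x v := by
        refine lintegral_congr_ae ?_
        filter_upwards [ae_restrict_mem measurableSet_Ioi, hf.ofReal_rpow_mul hα] with x hx h
        have hx0 : 0 < x := hx
        have e : x ^ (-s) = x ^ (-s - 2 * α) * x ^ (2 * α) := by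
          rw [← rpow_add hx0]
          congr 1
          ring
        rw [e, ENNReal.ofReal_mul (by positivity), mul_assoc, h, mul_left_comm]
        congr 1
        rw [← lintegral_const_mul _ (by fun_prop)]
        have : ∀ v, F x v = indicator (Iio x) (fun v => ENNReal.ofReal (x ^ (-s - 2 * α)) *
            (ENNReal.ofReal ((x - v) ^ (α - 1)) * ENNReal.ofReal (f v))) v := by
          intro v
          by_cases hv : v < x
          · have hxv := (sub_pos.2 hv).le
            simp only [F, indicator, mem_ofPred_eq, mem_Iio, hv, if_true]
            rw [ENNReal.ofReal_mul (by positivity)]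
            ring
          · simp [F, indicator, hv]
        simp_rw [this]
        rw [setLIntegral_indicator measurableSet_Iio, Iio_inter_Ioi]
    _ = ENNReal.ofReal (1 / Gamma α) * ∫⁻ v in Ioi 0, ∫⁻ x in Ioi 0, F x v := by
        rw [lintegral_const_mul _ (by fun_prop), lintegral_lintegral_swap hF.aemeasurable]
    _ = ENNReal.ofReal (1 / Gamma α) * ∫⁻ v in Ioi 0,
          ENNReal.ofReal (ProbabilityTheory.beta (s + α) α) *
            (ENNReal.ofReal (v ^ (-(s + α))) * ENNReal.ofReal (f v)) := by
        congr 1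
        refine setLIntegral_congr_fun measurableSet_Ioi fun v hv => ?_
        have hv0 : 0 < v := hv
        have : ∀ x, F x v = indicator (Ioi v) (fun x =>
            ENNReal.ofReal ((x - v) ^ (α - 1) * x ^ (-s - 2 * α)) * ENNReal.ofReal (f v)) x :=
          fun x => rfl
        simp_rw [this]
        rw [setLIntegral_indicator measurableSet_Ioi,
          inter_eq_left.2 (Ioi_subset_Ioi hv0.le), lintegral_mul_const _ (by fun_prop),
          lintegral_Ioi_sub_rpow_mul_rpow hα hs hv0]
        ring
    _ = _ := by
        have hβ := ProbabilityTheory.beta_pos hs hα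
        rw [lintegral_const_mul _ (by fun_prop), ← mul_assoc, negMoment,
          ← ENNReal.ofReal_mul (by positivity)]
        congr 2
        rw [ProbabilityTheory.beta]
        field_simp

theorem negMoment_ne_zero (hf : IsDensitySolution α m f) (s : ℝ) : negMoment f s ≠ 0 := by
  have hmeas : Measurable f := hf.1
  intro h
  rw [negMoment, lintegral_eq_zero_iff (by fun_prop)] at h
  have h0 : negMoment f 0 = 0 := by
    rw [negMoment, lintegral_eq_zero_iff (by fun_prop)]
    filter_upwards [h, ae_restrict_mem measurableSet_Ioi] with x hx hx0
    simpa [(rpow_pos_of_pos (mem_Ioi.1 hx0) (-s)).not_ge] using hx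
  rw [hf.negMoment_zero] at h0
  exact one_ne_zero h0

theorem negMoment_add_ne_top (hα : 0 < α) (hf : IsDensitySolution α (2 * α) f) {s : ℝ}
    (hs : 0 < s + α) : negMoment f (s + α) ≠ ⊤ ↔ negMoment f s ≠ ⊤ := by
  have h1 := Gamma_pos_of_pos hs
  have h2 := Gamma_pos_of_pos (add_pos hs hα)
  have h0 : ENNReal.ofReal (Gamma (s + α) / Gamma (s + α + α)) ≠ 0 :=
    (ENNReal.ofReal_pos.2 (by positivity)).ne'
  rw [hf.negMoment_eq hα hs]
  simp [ENNReal.mul_eq_top, h0]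

theorem negMoment_ne_top_of_nonneg (hα : 0 < α) (hf : IsDensitySolution α (2 * α) f) {s : ℝ}
    (hs : 0 ≤ s) : negMoment f s ≠ ⊤ := by
  have hmeas : Measurable f := hf.1
  have hnat : ∀ n : ℕ, negMoment f (n * α) ≠ ⊤ := by
    intro n
    induction n with
    | zero => simp [hf.negMoment_zero]
    | succ n ih =>
      rw [Nat.cast_succ, add_one_mul]
      exact (hf.negMoment_add_ne_top hα (by positivity)).2 ih
  obtain ⟨n, hn⟩ := exists_nat_ge (s / α)
  rw [div_le_iff₀ hα] at hn
  refine ne_top_of_le_ne_top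
    (ENNReal.add_ne_top.2 ⟨hf.negMoment_zero.trans_ne ENNReal.one_ne_top, hnat n⟩) ?_
  rw [negMoment, negMoment, negMoment, ← lintegral_add_left (by fun_prop)]
  refine setLIntegral_mono' measurableSet_Ioi fun x hx => ?_
  have hx0 : 0 < x := hx
  rw [← add_mul, ← ENNReal.ofReal_add (by positivity) (by positivity)]
  gcongr
  rcases le_total 1 x with h1 | h1
  · have h2 := rpow_le_rpow_of_exponent_le h1 (show -s ≤ -0 by linarith)
    have h3 := rpow_pos_of_pos hx0 (-(n * α))
    linarith
  · have h2 := rpow_le_rpow_of_exponent_ge hx0 h1 (show -(n * α) ≤ -s by linarith)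
    have h3 := rpow_pos_of_pos hx0 (-0)
    linarith

theorem negMoment_ne_top (hα : 0 < α) (hf : IsDensitySolution α (2 * α) f) {s : ℝ}
    (hs : -α < s) : negMoment f s ≠ ⊤ :=
  (hf.negMoment_add_ne_top hα (by linarith)).1
    (hf.negMoment_ne_top_of_nonneg hα (by linarith))

theorem toReal_negMoment_pos (hα : 0 < α) (hf : IsDensitySolution α (2 * α) f) {s : ℝ}
    (hs : -α < s) : 0 < (negMoment f s).toReal :=
  ENNReal.toReal_pos (hf.negMoment_ne_zero s) (hf.negMoment_ne_top hα hs)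

theorem toReal_negMoment_eq (hα : 0 < α) (hf : IsDensitySolution α (2 * α) f) {s : ℝ}
    (hs : -α < s) :
    (negMoment f s).toReal =
      Gamma (s + α) / Gamma (s + α + α) * (negMoment f (s + α)).toReal := by
  have h1 := Gamma_pos_of_pos (show 0 < s + α by linarith)
  have h2 := Gamma_pos_of_pos (show 0 < s + α + α by linarith)
  rw [hf.negMoment_eq hα (by linarith), ENNReal.toReal_mul, ENNReal.toReal_ofReal (by positivity)]

theorem convexOn_log_negMoment (hα : 0 < α) (hf : IsDensitySolution α (2 * α) f) :
    ConvexOn ℝ (Ici 0) fun s => log (negMoment f s).toReal := by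
  have hmeas : Measurable f := hf.1
  refine convexOn_iff_forall_pos.2 ⟨convex_Ici 0, fun s hs t ht a b ha hb hab => ?_⟩
  have hs' : -α < s := by linarith [mem_Ici.1 hs]
  have ht' : -α < t := by linarith [mem_Ici.1 ht]
  have hsp := hf.toReal_negMoment_pos hα hs'
  have htp := hf.toReal_negMoment_pos hα ht'
  have hst : -α < a * s + b * t := by
    have := mul_nonneg ha.le (mem_Ici.1 hs)
    have := mul_nonneg hb.le (mem_Ici.1 ht)
    linarith
  have hle : negMoment f (a * s + b * t) ≤ negMoment f s ^ a * negMoment f t ^ b := by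
    refine le_trans (le_of_eq ?_) (ENNReal.lintegral_mul_norm_pow_le (by fun_prop) (by fun_prop)
      ha.le hb.le hab)
    refine setLIntegral_congr_fun measurableSet_Ioi fun x hx => ?_
    have hx0 : 0 < x := hx
    rw [ENNReal.mul_rpow_of_nonneg _ _ ha.le, ENNReal.mul_rpow_of_nonneg _ _ hb.le,
      mul_mul_mul_comm, ← ENNReal.rpow_add_of_nonneg _ _ ha.le hb.le, hab, ENNReal.rpow_one,
      ENNReal.ofReal_rpow_of_pos (by positivity), ENNReal.ofReal_rpow_of_pos (by positivity),
      ← rpow_mul hx0.le, ← rpow_mul hx0.le,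
      ← ENNReal.ofReal_mul (p := x ^ (-s * a)) (by positivity), ← rpow_add hx0]
    congr 3
    ring
  have hle' := ENNReal.toReal_mono (ENNReal.mul_ne_top
    (ENNReal.rpow_ne_top_of_nonneg ha.le (hf.negMoment_ne_top hα hs'))
    (ENNReal.rpow_ne_top_of_nonneg hb.le (hf.negMoment_ne_top hα ht'))) hle
  rw [ENNReal.toReal_mul, ← ENNReal.toReal_rpow, ← ENNReal.toReal_rpow] at hle'
  simp only [smul_eq_mul]
  rw [← log_rpow hsp, ← log_rpow htp, ← log_mul (by positivity) (by positivity)]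
  exact log_le_log (hf.toReal_negMoment_pos hα hst) hle'

theorem log_negMoment (hα : 0 < α) (hf : IsDensitySolution α (2 * α) f) {s : ℝ} (hs : 0 ≤ s) :
    log (negMoment f s).toReal = log (Gamma (s + α)) - log (Gamma α) := by
  have h := sub_eq_log_Gamma_sub_of_convexOn hα (hf.convexOn_log_negMoment hα)
    (fun t ht => ?_) hs
  · simpa [hf.negMoment_zero] using h
  · have h1 := Gamma_pos_of_pos (show 0 < t + α by linarith)
    have h2 := Gamma_pos_of_pos (show 0 < t + α + α by linarith)
    have h3 := hf.toReal_negMoment_pos hα (show -α < t + α by linarith)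
    rw [hf.toReal_negMoment_eq hα (show -α < t by linarith), log_mul (by positivity) h3.ne',
      log_div h1.ne' h2.ne']
    ring

theorem toReal_negMoment_congr (hα : 0 < α) (hf : IsDensitySolution α (2 * α) f)
    (hg : IsDensitySolution α (2 * α) g) {s : ℝ} (hs : -α < s) :
    (negMoment f s).toReal = (negMoment g s).toReal := by
  rw [hf.toReal_negMoment_eq hα hs, hg.toReal_negMoment_eq hα hs]
  congr 1
  refine log_injOn_pos (hf.toReal_negMoment_pos hα (by linarith))
    (hg.toReal_negMoment_pos hα (by linarith)) ?_
  rw [hf.log_negMoment hα (by linarith), hg.log_negMoment hα (by linarith)]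

end IsDensitySolution

/-- The measure on `(0, ∞)` with density `f`. -/
def densityMeasure (f : ℝ → ℝ) : Measure ℝ :=
  (volume.restrict (Ioi 0)).withDensity fun x => ENNReal.ofReal (f x)

theorem lintegral_exp_densityMeasure {f : ℝ → ℝ} (hf : Measurable f) (s : ℝ) :
    ∫⁻ x, ENNReal.ofReal (exp (s * -log x)) ∂densityMeasure f = negMoment f s := by
  rw [densityMeasure, lintegral_withDensity_eq_lintegral_mul _ (by fun_prop) (by fun_prop)]
  refine setLIntegral_congr_fun measurableSet_Ioi fun x hx => ?_
  have hx0 : 0 < x := hx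
  rw [Pi.mul_apply, mul_comm, rpow_def_of_pos hx0]
  congr 3
  ring

namespace IsDensitySolution

variable {α m : ℝ} {f g : ℝ → ℝ}

open ProbabilityTheory

theorem isFiniteMeasure (hf : IsDensitySolution α m f) : IsFiniteMeasure (densityMeasure f) :=
  isFiniteMeasure_withDensity_ofReal hf.integrableOn.2

theorem mem_integrableExpSet (hα : 0 < α) (hf : IsDensitySolution α (2 * α) f) {s : ℝ}
    (hs : -α < s) : s ∈ integrableExpSet (fun x => -log x) (densityMeasure f) := by
  refine ⟨by fun_prop, ?_⟩
  rw [hasFiniteIntegral_iff_ofReal (ae_of_all _ fun x => (exp_pos _).le),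
    lintegral_exp_densityMeasure hf.1]
  exact (hf.negMoment_ne_top hα hs).lt_top

theorem mgf_eq (hf : IsDensitySolution α m f) (s : ℝ) :
    mgf (fun x => -log x) (densityMeasure f) s = (negMoment f s).toReal := by
  rw [mgf, integral_eq_lintegral_of_nonneg_ae (ae_of_all _ fun x => (exp_pos _).le)
    (by fun_prop), lintegral_exp_densityMeasure hf.1]

theorem densityMeasure_congr (hα : 0 < α) (hf : IsDensitySolution α (2 * α) f)
    (hg : IsDensitySolution α (2 * α) g) : densityMeasure f = densityMeasure g := by
  have := hf.isFiniteMeasure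
  have := hg.isFiniteMeasure
  have hmap := Measure.map_eq_of_mgf_eqOn (X := fun x : ℝ => -log x) (Y := fun x : ℝ => -log x)
    (μ := densityMeasure f) (μ' := densityMeasure g) (by fun_prop) (by fun_prop)
    (neg_lt_zero.2 hα) one_pos (fun s hs => hf.mem_integrableExpSet hα hs.1)
    (fun s hs => hg.mem_integrableExpSet hα hs.1) fun s hs => by
      rw [hf.mgf_eq, hg.mgf_eq, hf.toReal_negMoment_congr hα hg hs.1]
  have hinv : ∀ h : ℝ → ℝ,
      ((densityMeasure h).map fun x => -log x).map (fun y => exp (-y)) = densityMeasure h := by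
    intro h
    rw [Measure.map_map (by fun_prop) (by fun_prop)]
    conv_rhs => rw [← Measure.map_id (μ := densityMeasure h)]
    refine Measure.map_congr ?_
    refine (withDensity_absolutelyContinuous _ _).ae_le ?_
    filter_upwards [ae_restrict_mem measurableSet_Ioi] with x hx
    simp [exp_log (mem_Ioi.1 hx)]
  rw [← hinv f, hmap, hinv g]

theorem ae_eq (hα : 0 < α) (hf : IsDensitySolution α (2 * α) f)
    (hg : IsDensitySolution α (2 * α) g) : f =ᵐ[volume.restrict (Ioi 0)] g := by
  have hfm := hf.1
  have hgm := hg.1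
  have h := (withDensity_eq_iff_of_sigmaFinite (by fun_prop) (by fun_prop)).1
    (hf.densityMeasure_congr hα hg)
  filter_upwards [h, ae_restrict_mem measurableSet_Ioi] with x hx hx0
  exact (ENNReal.ofReal_eq_ofReal_iff (hf.2.1 x hx0) (hg.2.1 x hx0)).1 hx

theorem eqOn (hα : 0 < α) (hf : IsDensitySolution α (2 * α) f)
    (hg : IsDensitySolution α (2 * α) g) : EqOn f g (Ioi 0) := by
  intro x hx
  have hx0 : 0 < x := hx
  refine mul_left_cancel₀ (rpow_pos_of_pos hx0 (2 * α)).ne' ?_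
  rw [hf.2.2.2 x hx, hg.2.2.2 x hx]
  congr 1
  refine integral_congr_ae ?_
  filter_upwards [ae_restrict_of_ae_restrict_of_subset Ioo_subset_Ioi_self (hf.ae_eq hα hg)]
    with v hv
  rw [hv]

end IsDensitySolution

/-- For `m = 2α`, the function `x ↦ x^{−α−1} e^{−1/x} / Γ(α)` (the density of the
inverse of a Gamma random variable of parameter `α`) is the unique density
solution on `(0,∞)`. -/
theorem density_solution_two_alpha (α : ℝ) (hα : 0 < α) :
    IsDensitySolution α (2 * α) (fun x : ℝ => x ^ (-α - 1) * Real.exp (-1 / x) / Real.Gamma α) ∧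
    ∀ g : ℝ → ℝ, IsDensitySolution α (2 * α) g →
      ∀ x ∈ Set.Ioi (0:ℝ),
        g x = x ^ (-α - 1) * Real.exp (-1 / x) / Real.Gamma α := by
  refine ⟨isDensitySolution_inv_gamma hα, fun g hg x hx => ?_⟩
  exact hg.eqOn hα (isDensitySolution_inv_gamma hα) hx
end
end

section
/- Let α > 0, m > α, and let f be a density solution to the equation x^m f(x) = (1/Γ(α)) ∫_0^x (x−v)^{α−1} f(v) dv on (0,∞). Define h(x) = x^{−1−α} f(1/x) for x > 0. Then h is a positive solution to the dual right-sided equation: for every x > 0, x^{2α−m} h(x) = (1/Γ(α)) ∫_x^∞ (v−x)^{α−1} h(v) dv. -/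
open MeasureTheory Real Set Filter

noncomputable section

/-- The change of variables `v = 1/u` maps integrals over `(x,∞)` to integrals over `(0,1/x)`. -/
theorem integral_Ioi_eq_integral_Ioo_inv {x : ℝ} (hx : 0 < x) (F : ℝ → ℝ) :
    ∫ v in Set.Ioi x, F v = ∫ u in Set.Ioo (0:ℝ) x⁻¹, (u ^ 2)⁻¹ * F u⁻¹ := by
  have himg : (fun u : ℝ => u⁻¹) '' Set.Ioo 0 x⁻¹ = Set.Ioi x := by
    rw [Set.image_inv_eq_inv, Set.inv_Ioo_0_left (inv_pos.mpr hx), inv_inv]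
  have hderiv : ∀ u ∈ Set.Ioo (0:ℝ) x⁻¹,
      HasDerivWithinAt (fun u : ℝ => u⁻¹) (-(u ^ 2)⁻¹) (Set.Ioo 0 x⁻¹) u := fun u hu =>
    (hasDerivAt_inv hu.1.ne').hasDerivWithinAt
  rw [← himg, integral_image_eq_integral_abs_deriv_smul measurableSet_Ioo hderiv
    inv_injective.injOn]
  refine setIntegral_congr_fun measurableSet_Ioo fun u _ => ?_
  simp only [abs_neg, smul_eq_mul]
  rw [abs_of_nonneg (by positivity)]

/-- The kernel identity behind the duality between left- and right-sided fractional integrals. -/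
theorem inv_sub_rpow_mul_inv_rpow {α x u : ℝ} (hx : 0 < x) (hu : 0 < u) (hux : u < x⁻¹) :
    (u ^ 2)⁻¹ * ((u⁻¹ - x) ^ (α - 1) * u⁻¹ ^ (-1 - α)) =
      x ^ (α - 1) * (x⁻¹ - u) ^ (α - 1) := by
  have hpos : 0 < x⁻¹ - u := sub_pos.mpr hux
  have hfac : u⁻¹ - x = x * (x⁻¹ - u) * u⁻¹ := by field_simp
  have hpow : (u ^ 2)⁻¹ = u⁻¹ ^ (2 : ℝ) := by rw [Real.rpow_two, inv_pow]
  have hone : u⁻¹ ^ (2 : ℝ) * u⁻¹ ^ (α - 1) * u⁻¹ ^ (-1 - α) = 1 := by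
    rw [← Real.rpow_add (inv_pos.mpr hu), ← Real.rpow_add (inv_pos.mpr hu),
      show (2 : ℝ) + (α - 1) + (-1 - α) = 0 by ring, Real.rpow_zero]
  rw [hfac, Real.mul_rpow (by positivity) (by positivity), Real.mul_rpow hx.le hpos.le, hpow]
  linear_combination (x ^ (α - 1) * (x⁻¹ - u) ^ (α - 1)) * hone

/-- Dual equation: if `f` is a density solution and `h(x) = x^{−1−α} f(1/x)`,
then `x^{2α−m} h(x) = (1/Γ(α)) ∫_x^∞ (v−x)^{α−1} h(v) dv` for every `x > 0`. -/
theorem density_solution_dual_equation (α m : ℝ) (hα : 0 < α) (hm : α < m)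
    (f : ℝ → ℝ) (hf : IsDensitySolution α m f)
    (h : ℝ → ℝ) (hh : ∀ x ∈ Set.Ioi (0:ℝ), h x = x ^ (-1 - α) * f (1 / x)) :
    ∀ x ∈ Set.Ioi (0:ℝ),
      x ^ (2 * α - m) * h x =
        (1 / Real.Gamma α) * ∫ v in Set.Ioi x, (v - x) ^ (α - 1) * h v := by
  obtain ⟨-, -, -, heq⟩ := hf
  intro x hx
  have hx0 : 0 < x := hx
  have hint : ∫ v in Set.Ioi x, (v - x) ^ (α - 1) * h v =
      x ^ (α - 1) * ∫ u in Set.Ioo (0:ℝ) x⁻¹, (x⁻¹ - u) ^ (α - 1) * f u := by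
    rw [integral_Ioi_eq_integral_Ioo_inv hx0, ← integral_const_mul]
    refine setIntegral_congr_fun measurableSet_Ioo fun u hu => ?_
    rw [hh u⁻¹ (inv_pos.mpr hu.1), one_div, inv_inv]
    linear_combination f u * inv_sub_rpow_mul_inv_rpow (α := α) hx0 hu.1 hu.2
  have hpow : x ^ (2 * α - m) * x ^ (-1 - α) = x ^ (α - 1) * x⁻¹ ^ m := by
    rw [Real.inv_rpow hx0.le, ← Real.rpow_neg hx0.le, ← Real.rpow_add hx0, ← Real.rpow_add hx0]
    congr 1
    ring
  rw [hint, hh x hx, one_div x]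
  linear_combination f x⁻¹ * hpow + x ^ (α - 1) * heq x⁻¹ (inv_pos.mpr hx0)
end
end

section
/- Let m = 1 and α ∈ (0,1), and let f be the unique density solution to the equation x f(x) = (1/Γ(α)) ∫_0^x (x−v)^{α−1} f(v) dv on (0,∞). Then for every λ ≥ 0, the Laplace transform satisfies ∫_0^∞ e^{−λx} f(x) dx = exp( −λ^{1−α}/(1−α) ). (Thus f is the density of (1−α)^{1/(α−1)} Z_{1−α}, where Z_β denotes the standard positive β-stable random variable with E[e^{−λ Z_β}] = e^{−λ^β}.) -/
open MeasureTheory Real Set Filter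

noncomputable section

/-- For `s, x ≥ 0`, the factor `e^{-s x}` does not increase the norm. -/
lemma norm_exp_mul_le {s x : ℝ} (hs : 0 ≤ s) (hx : 0 ≤ x) (y : ℝ) :
    ‖Real.exp (-s * x) * y‖ ≤ ‖y‖ := by
  rw [norm_mul, Real.norm_of_nonneg (Real.exp_pos _).le]
  refine mul_le_of_le_one_left (norm_nonneg _) (Real.exp_le_one_iff.2 ?_)
  nlinarith [mul_nonneg hs hx]

lemma integrableOn_exp_mul {f : ℝ → ℝ} (hint : IntegrableOn f (Ioi 0)) {l : ℝ} (hl : 0 ≤ l) :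
    IntegrableOn (fun x => Real.exp (-l * x) * f x) (Ioi 0) := by
  refine Integrable.mono hint
    ((by fun_prop : Continuous fun x : ℝ => Real.exp (-l * x)).aestronglyMeasurable.mul
      hint.aestronglyMeasurable) ?_
  filter_upwards [ae_restrict_mem measurableSet_Ioi] with x hx
  exact norm_exp_mul_le hl (le_of_lt hx) _

/-- For `l > 0`, a density solution with `m = 1` has
`∫ x e^{-l x} f(x) dx = l^{-α} ∫ e^{-l x} f(x) dx`. -/
lemma IsDensitySolution.integral_id_mul_exp {α : ℝ} (hα : 0 < α) {f : ℝ → ℝ}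
    (hf : IsDensitySolution α 1 f) (hint : IntegrableOn f (Ioi 0)) {l : ℝ} (hl : 0 < l) :
    ∫ x in Ioi (0:ℝ), x * (Real.exp (-l * x) * f x) =
      l ^ (-α) * ∫ x in Ioi (0:ℝ), Real.exp (-l * x) * f x := by
  have hΓ : Real.Gamma α ≠ 0 := (Real.Gamma_pos_of_pos hα).ne'
  have hval := Real.integral_rpow_mul_exp_neg_mul_Ioi hα hl
  have hg : IntegrableOn (fun u : ℝ => u ^ (α - 1) * Real.exp (-(l * u))) (Ioi 0) := by
    refine not_imp_comm.1 integral_undef ?_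
    rw [hval]
    positivity
  have hconv := integral_posConvolution (integrableOn_exp_mul hint hl.le) hg
    (ContinuousLinearMap.mul ℝ ℝ)
  simp only [ContinuousLinearMap.mul_apply'] at hconv
  have hpt : ∀ x ∈ Ioi (0:ℝ), x * (Real.exp (-l * x) * f x) = (1 / Real.Gamma α) *
      ∫ t in (0:ℝ)..x, Real.exp (-l * t) * f t *
        ((x - t) ^ (α - 1) * Real.exp (-(l * (x - t)))) := by
    intro x hx
    have h := hf.2.2.2 x hx
    rw [Real.rpow_one] at h
    rw [intervalIntegral.integral_of_le (le_of_lt hx), integral_Ioc_eq_integral_Ioo,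
      mul_left_comm, h, mul_left_comm, ← integral_const_mul]
    congr 2
    ext t
    have : Real.exp (-l * x) = Real.exp (-l * t) * Real.exp (-(l * (x - t))) := by
      rw [← Real.exp_add]; ring_nf
    rw [this]; ring
  rw [setIntegral_congr_fun measurableSet_Ioi hpt, integral_const_mul, hconv, hval,
    one_div, one_div, Real.inv_rpow hl.le, Real.rpow_neg hl.le]
  field_simp

/-- For `l > 0`, the Laplace transform of an integrable function on `(0,∞)` may be differentiated
under the integral sign. -/
lemma hasDerivAt_laplace {f : ℝ → ℝ} (hint : IntegrableOn f (Ioi 0)) {l : ℝ} (hl : 0 < l) :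
    HasDerivAt (fun s => ∫ x in Ioi (0:ℝ), Real.exp (-s * x) * f x)
      (-∫ x in Ioi (0:ℝ), x * (Real.exp (-l * x) * f x)) l := by
  have hm := hint.aestronglyMeasurable
  have key := hasDerivAt_integral_of_dominated_loc_of_deriv_le
    (μ := volume.restrict (Ioi (0:ℝ))) (F := fun s x => Real.exp (-s * x) * f x)
    (F' := fun s x => -(x * (Real.exp (-s * x) * f x))) (x₀ := l)
    (bound := fun x => (2 / l) * ‖f x‖)
    (Ioi_mem_nhds (half_lt_self hl))
    (Eventually.of_forall fun s => by
      exact (by fun_prop : Continuous fun x : ℝ => Real.exp (-s * x)).aestronglyMeasurable.mul hm)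
    (integrableOn_exp_mul hint hl.le)
    (by
      exact (continuous_id.aestronglyMeasurable.mul
        ((by fun_prop : Continuous fun x : ℝ => Real.exp (-l * x)).aestronglyMeasurable.mul
          hm)).neg)
    (by
      filter_upwards [ae_restrict_mem measurableSet_Ioi] with x hx s hs
      have hx : 0 < x := hx
      have hs : l / 2 < s := hs
      have hs0 : 0 < s := by linarith
      have h1 : x * Real.exp (-s * x) ≤ 2 / l := by
        have h2 : s * x ≤ Real.exp (s * x) := by linarith [Real.add_one_le_exp (s * x)]
        have h3 : l / 2 * x ≤ Real.exp (s * x) :=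
          (mul_le_mul_of_nonneg_right hs.le hx.le).trans h2
        rw [neg_mul, Real.exp_neg, ← div_eq_mul_inv, div_le_div_iff₀ (Real.exp_pos _) hl]
        linarith
      rw [norm_neg, ← mul_assoc, norm_mul, Real.norm_of_nonneg (by positivity)]
      gcongr)
    (hint.norm.const_mul _)
    (Eventually.of_forall fun x s _ => by
      refine (((hasDerivAt_id s).neg.mul_const x).exp.mul_const (f x)).congr_deriv ?_
      simp only [Pi.neg_apply, id_eq]
      ring)
  rw [← integral_neg]
  exact key.2

/-- The Laplace transform of an integrable function on `(0,∞)` is continuous on `[0,∞)`. -/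
lemma continuousOn_laplace {f : ℝ → ℝ} (hint : IntegrableOn f (Ioi 0)) :
    ContinuousOn (fun s => ∫ x in Ioi (0:ℝ), Real.exp (-s * x) * f x) (Ici 0) := by
  refine continuousOn_of_dominated (bound := fun x => ‖f x‖)
    (fun s hs => (integrableOn_exp_mul hint hs).aestronglyMeasurable) (fun s hs => ?_)
    hint.norm (Eventually.of_forall fun x => by fun_prop)
  filter_upwards [ae_restrict_mem measurableSet_Ioi] with x hx
  exact norm_exp_mul_le hs (le_of_lt hx) _

/-- For `m = 1` and `α ∈ (0,1)`, the Laplace transform of the density solution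
is `exp(−λ^{1−α}/(1−α))` for every `λ ≥ 0`. -/
theorem density_solution_stable_laplace (α : ℝ) (hα : α ∈ Set.Ioo (0:ℝ) 1)
    (f : ℝ → ℝ) (hf : IsDensitySolution α 1 f) :
    ∀ l : ℝ, 0 ≤ l →
      (∫ x in Set.Ioi (0:ℝ), Real.exp (-l * x) * f x) =
        Real.exp (-l ^ (1 - α) / (1 - α)) := by
  have hα1 : 0 < 1 - α := sub_pos.2 hα.2
  have hint : IntegrableOn f (Ioi 0) := by
    refine not_imp_comm.1 integral_undef ?_
    rw [hf.2.2.1]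
    exact one_ne_zero
  intro l hl
  rcases hl.eq_or_lt with rfl | hl
  · simp [Real.zero_rpow hα1.ne', hf.2.2.1]
  have hcont : ContinuousOn (fun s => (∫ x in Ioi (0:ℝ), Real.exp (-s * x) * f x) *
      Real.exp (s ^ (1 - α) / (1 - α))) (Icc 0 l) := by
    refine ((continuousOn_laplace hint).mono Icc_subset_Ici_self).mul (Continuous.continuousOn ?_)
    exact Real.continuous_exp.comp ((Real.continuous_rpow_const hα1.le).div_const _)
  have hder : ∀ s ∈ Ioo 0 l, HasDerivAt (fun s => (∫ x in Ioi (0:ℝ), Real.exp (-s * x) * f x) *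
      Real.exp (s ^ (1 - α) / (1 - α))) 0 s := by
    intro s hs
    have h1 := hasDerivAt_laplace hint hs.1
    rw [hf.integral_id_mul_exp hα.1 hint hs.1] at h1
    have h2 := ((Real.hasDerivAt_rpow_const (p := 1 - α) (Or.inl hs.1.ne')).div_const (1 - α)).exp
    refine (h1.mul h2).congr_deriv ?_
    rw [mul_div_cancel_left₀ _ hα1.ne', show 1 - α - 1 = -α by ring]
    ring
  obtain ⟨c, -, hc⟩ := exists_hasDerivAt_eq_slope _ _ hl hcont hder
  have hconst := (div_eq_zero_iff.1 hc.symm).resolve_right (by linarith)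
  simp only [neg_zero, zero_mul, Real.exp_zero, one_mul, hf.2.2.1, Real.zero_rpow hα1.ne',
    zero_div] at hconst
  rw [neg_div, Real.exp_neg]
  exact eq_inv_of_mul_eq_one_left (by linarith)
end
end

section
/- Let m = 2 and α ∈ (0,2), set ν = 1/(2−α), and let f be the unique density solution to the equation x^2 f(x) = (1/Γ(α)) ∫_0^x (x−v)^{α−1} f(v) dv on (0,∞). Then for every λ > 0, the Laplace transform satisfies ∫_0^∞ e^{−λx} f(x) dx = (1/Γ(ν)) ∫_0^∞ t^{ν−1} · exp( −t − ν² λ^{1/ν} / t ) dt; that is, it equals E[ exp( −ν² λ^{1/ν} Γ_ν^{−1} ) ] for a Gamma random variable Γ_ν of parameter ν. -/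
open MeasureTheory Real Set Filter

noncomputable section

open scoped Topology Nat

/-- A solution of `y'' = q y` on `(0, ∞)` with `q ≥ 0` that vanishes at both ends is zero. -/
theorem eq_zero_of_second_deriv_eq_mul {q y y' : ℝ → ℝ} (hq : ∀ x, 0 < x → 0 ≤ q x)
    (hy : ∀ x, 0 < x → HasDerivAt y (y' x) x)
    (hy' : ∀ x, 0 < x → HasDerivAt y' (q x * y x) x)
    (h_zero : Tendsto y (𝓝[>] 0) (𝓝 0)) (h_top : Tendsto y atTop (𝓝 0))
    {x : ℝ} (hx : 0 < x) : y x = 0 := by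
  have hsq : ∀ t, 0 < t → HasDerivAt (fun t ↦ y t ^ 2) (2 * (y t * y' t)) t := fun t ht ↦ by
    simpa [mul_assoc] using (hy t ht).fun_pow 2
  have hsq' : ∀ t, 0 < t →
      HasDerivAt (fun t ↦ 2 * (y t * y' t)) (2 * (y' t * y' t + y t * (q t * y t))) t :=
    fun t ht ↦ ((hy t ht).mul (hy' t ht)).const_mul 2
  have hconv : ConvexOn ℝ (Ioi 0) (fun t ↦ y t ^ 2) := by
    refine convexOn_of_hasDerivWithinAt2_nonneg (convex_Ioi 0)
      (f' := fun t ↦ 2 * (y t * y' t)) (f'' := fun t ↦ 2 * (y' t * y' t + y t * (q t * y t)))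
      (fun t ht ↦ (hsq t ht).continuousAt.continuousWithinAt) ?_ ?_ ?_ <;>
      simp only [interior_Ioi]
    · exact fun t ht ↦ (hsq t ht).hasDerivWithinAt
    · exact fun t ht ↦ (hsq' t ht).hasDerivWithinAt
    · intro t ht
      have := mul_nonneg (hq t ht) (sq_nonneg (y t))
      nlinarith [sq_nonneg (y' t)]
  have hle : ∀ ε > 0, y x ^ 2 ≤ ε := by
    intro ε hε
    have hsmall {l : Filter ℝ} (h : Tendsto y l (𝓝 0)) : ∀ᶠ t in l, y t ^ 2 < ε :=
      (by simpa using h.pow 2 : Tendsto (fun t ↦ y t ^ 2) l (𝓝 0)).eventually_lt_const hε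
    obtain ⟨a, ha, hax⟩ := ((hsmall h_zero).and (Ioo_mem_nhdsGT hx)).exists
    obtain ⟨b, hb, hxb⟩ := ((hsmall h_top).and (eventually_ge_atTop x)).exists
    exact (hconv.le_max_of_mem_Icc (mem_Ioi.2 hax.1) (mem_Ioi.2 (hx.trans_le hxb))
      ⟨hax.2.le, hxb⟩).trans (max_le ha.le hb.le)
  exact pow_eq_zero_iff two_ne_zero |>.1
    (le_antisymm (le_of_forall_pos_le_add fun ε hε ↦ by simpa using hle ε hε) (sq_nonneg _))

section ExponentialIntegral

variable {Ω : Type*} [MeasurableSpace Ω] {μ : Measure Ω} {w h : Ω → ℝ}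

theorem hasDerivAt_integral_mul_exp_neg_mul (hh : ∀ᵐ t ∂μ, 0 ≤ h t)
    (hw : ∀ s, 0 < s → Integrable (fun t ↦ w t * exp (-s * h t)) μ)
    (hhw : ∀ s, 0 < s → Integrable (fun t ↦ h t * w t * exp (-s * h t)) μ) {s : ℝ} (hs : 0 < s) :
    HasDerivAt (fun s ↦ ∫ t, w t * exp (-s * h t) ∂μ) (-∫ t, h t * w t * exp (-s * h t) ∂μ) s := by
  rw [← integral_neg]
  refine (hasDerivAt_integral_of_dominated_loc_of_deriv_le
    (F := fun s t ↦ w t * exp (-s * h t)) (F' := fun s t ↦ -(h t * w t * exp (-s * h t)))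
    (bound := fun t ↦ ‖h t * w t * exp (-(s / 2) * h t)‖) (Ioi_mem_nhds (half_lt_self hs))
    ?_ (hw s hs) (hhw s hs).neg.aestronglyMeasurable ?_ (hhw _ (half_pos hs)).norm ?_).2
  · filter_upwards [Ioi_mem_nhds hs] with r hr using (hw r hr).aestronglyMeasurable
  · filter_upwards [hh] with t ht r hr
    rw [norm_neg, norm_mul, norm_mul _ (exp _)]
    gcongr
    simp only [norm_eq_abs, abs_exp, exp_le_exp]
    have := mul_le_mul_of_nonneg_right (le_of_lt (mem_Ioi.1 hr)) ht
    linarith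
  · filter_upwards with t r _
    have := ((((hasDerivAt_id r).neg).mul_const (h t)).exp).const_mul (w t)
    convert! this using 1
    simp
    ring

theorem norm_mul_exp_neg_mul_le {w h s : ℝ} (hh : 0 ≤ h) (hs : 0 ≤ s) :
    ‖w * exp (-s * h)‖ ≤ ‖w‖ := by
  rw [norm_mul]
  refine mul_le_of_le_one_right (norm_nonneg _) ?_
  rw [norm_eq_abs, abs_exp, exp_le_one_iff]
  nlinarith [mul_nonneg hs hh]

theorem tendsto_integral_mul_exp_neg_mul_nhdsGT_zero (hw : Integrable w μ)
    (hm : AEStronglyMeasurable h μ) (hh : ∀ᵐ t ∂μ, 0 ≤ h t) :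
    Tendsto (fun s ↦ ∫ t, w t * exp (-s * h t) ∂μ) (𝓝[>] 0) (𝓝 (∫ t, w t ∂μ)) := by
  refine tendsto_integral_filter_of_dominated_convergence (fun t ↦ ‖w t‖) ?_ ?_ hw.norm ?_
  · exact .of_forall fun s ↦ hw.aestronglyMeasurable.mul
      (continuous_exp.comp_aestronglyMeasurable (hm.const_mul (-s)))
  · filter_upwards [self_mem_nhdsWithin] with s hs
    filter_upwards [hh] with t ht using norm_mul_exp_neg_mul_le ht (le_of_lt hs)
  · filter_upwards with t
    have : Continuous fun s : ℝ ↦ w t * exp (-s * h t) := by fun_prop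
    simpa using (this.tendsto 0).mono_left nhdsWithin_le_nhds

theorem tendsto_integral_mul_exp_neg_mul_atTop (hw : Integrable w μ)
    (hm : AEStronglyMeasurable h μ) (hh : ∀ᵐ t ∂μ, 0 < h t) :
    Tendsto (fun s ↦ ∫ t, w t * exp (-s * h t) ∂μ) atTop (𝓝 0) := by
  rw [← integral_zero Ω ℝ (μ := μ)]
  refine tendsto_integral_filter_of_dominated_convergence (fun t ↦ ‖w t‖) ?_ ?_ hw.norm ?_
  · exact .of_forall fun s ↦ hw.aestronglyMeasurable.mul
      (continuous_exp.comp_aestronglyMeasurable (hm.const_mul (-s)))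
  · filter_upwards [eventually_ge_atTop 0] with s hs
    filter_upwards [hh] with t ht using norm_mul_exp_neg_mul_le ht.le hs
  · filter_upwards [hh] with t ht
    have : Tendsto (fun s : ℝ ↦ -s * h t) atTop atBot :=
      tendsto_neg_atTop_atBot.atBot_mul_const ht
    simpa using (tendsto_exp_atBot.comp this).const_mul (w t)

end ExponentialIntegral

theorem pow_mul_exp_neg_mul_le (n : ℕ) {s x : ℝ} (hs : 0 < s) (hx : 0 ≤ x) :
    x ^ n * exp (-s * x) ≤ n ! / s ^ n := by
  have h := pow_div_factorial_le_exp _ (mul_nonneg hs.le hx) n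
  rw [neg_mul, exp_neg, ← div_eq_mul_inv, div_le_div_iff₀ (exp_pos _) (by positivity)]
  rw [div_le_iff₀ (by positivity), mul_pow] at h
  linarith

theorem IntegrableOn.pow_mul_mul_exp_neg_mul {f : ℝ → ℝ} (hf : IntegrableOn f (Ioi 0)) (n : ℕ)
    {s : ℝ} (hs : 0 < s) : IntegrableOn (fun x ↦ x ^ n * f x * exp (-s * x)) (Ioi 0) := by
  have : IntegrableOn (fun x ↦ (x ^ n * exp (-s * x)) * f x) (Ioi 0) := by
    refine Integrable.bdd_mul (c := n ! / s ^ n) hf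
      (by fun_prop : Measurable fun x : ℝ ↦ x ^ n * exp (-s * x)).aestronglyMeasurable ?_
    filter_upwards [ae_restrict_mem measurableSet_Ioi] with x (hx : 0 < x)
    rw [norm_of_nonneg (by positivity)]
    exact pow_mul_exp_neg_mul_le n hs hx.le
  exact this.congr_fun (fun x _ ↦ by ring) measurableSet_Ioi

/-- The integral `∫_0^∞ t^(a-1) exp(-t) exp(-s/t) dt`, a multiple of a modified Bessel function of
the second kind. -/
def expInvGamma (a s : ℝ) : ℝ :=
  ∫ t in Ioi (0:ℝ), t ^ (a - 1) * exp (-t) * exp (-s * t⁻¹)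

theorem exp_neg_mul_inv_le (n : ℕ) {s t : ℝ} (hs : 0 < s) (ht : 0 < t) (b : ℝ) :
    t ^ b * exp (-t) * exp (-s * t⁻¹) ≤ n ! / s ^ n * (t ^ (b + n) * exp (-t)) := by
  have h := pow_mul_exp_neg_mul_le n hs (inv_nonneg.2 ht.le)
  have hpow : t ^ b = t ^ (b + n) * t⁻¹ ^ n := by
    rw [rpow_add_natCast ht.ne', mul_assoc, ← mul_pow, mul_inv_cancel₀ ht.ne', one_pow, mul_one]
  calc t ^ b * exp (-t) * exp (-s * t⁻¹)
      = t⁻¹ ^ n * exp (-s * t⁻¹) * (t ^ (b + n) * exp (-t)) := by rw [hpow]; ring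
    _ ≤ _ := by gcongr

theorem integrableOn_expInvGamma (a : ℝ) {s : ℝ} (hs : 0 < s) :
    IntegrableOn (fun t : ℝ ↦ t ^ (a - 1) * exp (-t) * exp (-s * t⁻¹)) (Ioi 0) := by
  obtain ⟨n, hn⟩ := exists_nat_gt (-a)
  have hG := (GammaIntegral_convergent (by linarith : 0 < a + n)).const_mul ((n ! : ℝ) / s ^ n)
  refine Integrable.mono' hG (by fun_prop) ?_
  filter_upwards [ae_restrict_mem measurableSet_Ioi] with t (ht : 0 < t)
  rw [norm_of_nonneg (by positivity)]
  refine (exp_neg_mul_inv_le n hs ht _).trans_eq ?_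
  rw [show a - 1 + n = a + n - 1 by ring]
  ring

theorem hasDerivAt_expInvGamma (a : ℝ) {s : ℝ} (hs : 0 < s) :
    HasDerivAt (expInvGamma a) (-expInvGamma (a - 1) s) s := by
  have key : ∀ s : ℝ, EqOn (fun t : ℝ ↦ t ^ (a - 1 - 1) * exp (-t) * exp (-s * t⁻¹))
      (fun t : ℝ ↦ t⁻¹ * (t ^ (a - 1) * exp (-t)) * exp (-s * t⁻¹)) (Ioi 0) := by
    intro s t ht
    simp only [rpow_sub_one (ne_of_gt ht) (a - 1)]
    ring
  rw [expInvGamma, setIntegral_congr_fun measurableSet_Ioi (key s)]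
  refine hasDerivAt_integral_mul_exp_neg_mul ?_ (fun r hr ↦ integrableOn_expInvGamma a hr)
    (fun r hr ↦ (integrableOn_expInvGamma (a - 1) hr).congr_fun (key r) measurableSet_Ioi) hs
  filter_upwards [ae_restrict_mem measurableSet_Ioi] with t ht using inv_nonneg.2 (le_of_lt ht)

theorem tendsto_rpow_mul_exp_neg_mul_exp_neg_inv {l : Filter ℝ} (b : ℝ) {s : ℝ} (hs : 0 < s)
    (hl : ∀ᶠ t in l, 0 < t)
    (h : ∀ c : ℝ, 0 < c → Tendsto (fun t : ℝ ↦ t ^ c * exp (-t)) l (𝓝 0)) :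
    Tendsto (fun t : ℝ ↦ t ^ b * (exp (-t) * exp (-s * t⁻¹))) l (𝓝 0) := by
  obtain ⟨n, hn⟩ := exists_nat_gt (-b)
  refine squeeze_zero' (g := fun t ↦ (n ! : ℝ) / s ^ n * (t ^ (b + n) * exp (-t))) ?_ ?_ ?_
  · filter_upwards [hl] with t ht using by positivity
  · filter_upwards [hl] with t ht
    rw [← mul_assoc]
    exact exp_neg_mul_inv_le n hs ht b
  · simpa using (h (b + n) (by linarith)).const_mul ((n ! : ℝ) / s ^ n)

/-- The three-term recurrence for `expInvGamma`, from integration by parts. -/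
theorem mul_expInvGamma_sub_two (a : ℝ) {s : ℝ} (hs : 0 < s) :
    s * expInvGamma (a - 1 - 1) s = expInvGamma a s - (a - 1) * expInvGamma (a - 1) s := by
  have hu : ∀ t ∈ Ioi (0:ℝ), HasDerivAt (fun t : ℝ ↦ t ^ (a - 1)) ((a - 1) * t ^ (a - 1 - 1)) t :=
    fun t ht ↦ hasDerivAt_rpow_const (.inl (ne_of_gt ht))
  have hv : ∀ t ∈ Ioi (0:ℝ), HasDerivAt (fun t : ℝ ↦ exp (-t) * exp (-s * t⁻¹))
      ((s * t⁻¹ * t⁻¹ - 1) * (exp (-t) * exp (-s * t⁻¹))) t := by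
    intro t ht
    have h := (hasDerivAt_neg t).exp.mul
      (((hasDerivAt_inv (ne_of_gt ht)).const_mul (-s)).exp)
    convert! h using 1
    field_simp
    ring
  have key : EqOn (fun t : ℝ ↦ (a - 1) * (t ^ (a - 1 - 1) * exp (-t) * exp (-s * t⁻¹)) +
        (s * (t ^ (a - 1 - 1 - 1) * exp (-t) * exp (-s * t⁻¹)) -
        t ^ (a - 1) * exp (-t) * exp (-s * t⁻¹)))
      (fun t : ℝ ↦ (a - 1) * t ^ (a - 1 - 1) * (exp (-t) * exp (-s * t⁻¹)) +
        t ^ (a - 1) * ((s * t⁻¹ * t⁻¹ - 1) * (exp (-t) * exp (-s * t⁻¹)))) (Ioi 0) := by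
    intro t ht
    simp only [rpow_sub_one (ne_of_gt ht) (a - 1 - 1), rpow_sub_one (ne_of_gt ht) (a - 1)]
    ring
  have i0 := integrableOn_expInvGamma a hs
  have i1 := (integrableOn_expInvGamma (a - 1) hs).const_mul (a - 1)
  have i2 := (integrableOn_expInvGamma (a - 1 - 1) hs).const_mul s
  have i20 : IntegrableOn (fun t : ℝ ↦ s * (t ^ (a - 1 - 1 - 1) * exp (-t) * exp (-s * t⁻¹)) -
      t ^ (a - 1) * exp (-t) * exp (-s * t⁻¹)) (Ioi 0) := i2.sub i0
  have hparts := integral_Ioi_deriv_mul_eq_sub (a' := 0) (b' := 0) hu hv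
    (IntegrableOn.congr_fun (i1.add i20) key measurableSet_Ioi) ?_ ?_
  · rw [← setIntegral_congr_fun measurableSet_Ioi key, integral_add i1 i20,
      integral_sub i2 i0, integral_const_mul, integral_const_mul] at hparts
    simp only [expInvGamma]
    linarith
  · refine tendsto_rpow_mul_exp_neg_mul_exp_neg_inv _ hs self_mem_nhdsWithin fun c hc ↦ ?_
    have : ContinuousAt (fun t : ℝ ↦ t ^ c * exp (-t)) 0 :=
      (continuousAt_rpow_const 0 c (.inr hc.le)).mul (by fun_prop)
    simpa [zero_rpow hc.ne'] using this.tendsto.mono_left nhdsWithin_le_nhds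
  · refine tendsto_rpow_mul_exp_neg_mul_exp_neg_inv _ hs (eventually_gt_atTop 0) fun c _ ↦ ?_
    simpa using tendsto_rpow_mul_exp_neg_mul_atTop_nhds_zero c 1 one_pos

theorem integrableOn_rpow_mul_exp_neg {a : ℝ} (ha : 0 < a) :
    IntegrableOn (fun t : ℝ ↦ t ^ (a - 1) * exp (-t)) (Ioi 0) :=
  (GammaIntegral_convergent ha).congr_fun (fun _ _ ↦ mul_comm _ _) measurableSet_Ioi

theorem tendsto_expInvGamma_nhdsGT_zero {a : ℝ} (ha : 0 < a) :
    Tendsto (expInvGamma a) (𝓝[>] 0) (𝓝 (Gamma a)) := by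
  rw [Gamma_eq_integral ha]
  simp only [mul_comm (exp _)]
  refine tendsto_integral_mul_exp_neg_mul_nhdsGT_zero (integrableOn_rpow_mul_exp_neg ha)
    (by fun_prop) ?_
  filter_upwards [ae_restrict_mem measurableSet_Ioi] with t ht using inv_nonneg.2 (le_of_lt ht)

theorem tendsto_expInvGamma_atTop {a : ℝ} (ha : 0 < a) :
    Tendsto (expInvGamma a) atTop (𝓝 0) := by
  refine tendsto_integral_mul_exp_neg_mul_atTop (integrableOn_rpow_mul_exp_neg ha)
    (by fun_prop) ?_
  filter_upwards [ae_restrict_mem measurableSet_Ioi] with t ht using inv_pos.2 ht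

theorem hasDerivAt_sq_mul_rpow {ν l : ℝ} (hν : 0 < ν) (hl : 0 < l) :
    HasDerivAt (fun l : ℝ ↦ ν ^ 2 * l ^ (1 / ν)) (ν * l ^ (1 / ν - 1)) l := by
  convert! (hasDerivAt_rpow_const (p := 1 / ν) (.inl hl.ne')).const_mul (ν ^ 2) using 1
  field_simp

theorem hasDerivAt_expInvGamma_comp (a : ℝ) {ν l : ℝ} (hν : 0 < ν) (hl : 0 < l) :
    HasDerivAt (fun l ↦ expInvGamma a (ν ^ 2 * l ^ (1 / ν)))
      (-expInvGamma (a - 1) (ν ^ 2 * l ^ (1 / ν)) * (ν * l ^ (1 / ν - 1))) l :=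
  (hasDerivAt_expInvGamma a (by positivity)).comp l (hasDerivAt_sq_mul_rpow hν hl)

/-- The derivative of `l ↦ expInvGamma ν (ν² l^(1/ν))` has derivative `l^(1/ν-2)` times the
function. -/
theorem hasDerivAt_deriv_expInvGamma_comp {ν l : ℝ} (hν : 0 < ν) (hl : 0 < l) :
    HasDerivAt (fun l ↦ -expInvGamma (ν - 1) (ν ^ 2 * l ^ (1 / ν)) * (ν * l ^ (1 / ν - 1)))
      (l ^ (1 / ν - 2) * expInvGamma ν (ν ^ 2 * l ^ (1 / ν))) l := by
  have h := (hasDerivAt_expInvGamma_comp (ν - 1) hν hl).neg.mul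
    ((hasDerivAt_rpow_const (p := 1 / ν - 1) (.inl hl.ne')).const_mul ν)
  convert! h using 1
  have hrec := mul_expInvGamma_sub_two ν (by positivity : 0 < ν ^ 2 * l ^ (1 / ν))
  have hsq : l ^ (1 / ν - 1) * l ^ (1 / ν - 1) = l ^ (1 / ν) * l ^ (1 / ν - 2) := by
    rw [← rpow_add hl, ← rpow_add hl]
    ring_nf
  have hcancel : ν * (1 / ν - 1) = 1 - ν := by field_simp
  rw [Pi.neg_apply, show 1 / ν - 1 - 1 = 1 / ν - 2 by ring]
  linear_combination (-l ^ (1 / ν - 2)) * hrec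
    - ν ^ 2 * expInvGamma (ν - 1 - 1) (ν ^ 2 * l ^ (1 / ν)) * hsq
    + expInvGamma (ν - 1) (ν ^ 2 * l ^ (1 / ν)) * l ^ (1 / ν - 2) * hcancel

/-- The Laplace transform of the fractional integral of `f`. -/
theorem integral_exp_neg_mul_fractional_integral {α l : ℝ} (hα : 0 < α) (hl : 0 < l) {f : ℝ → ℝ}
    (hf : IntegrableOn f (Ioi 0)) :
    ∫ x in Ioi (0:ℝ), (∫ v in Ioo (0:ℝ) x, (x - v) ^ (α - 1) * f v) * exp (-l * x) =
      Gamma α * l ^ (-α) * ∫ x in Ioi (0:ℝ), f x * exp (-l * x) := by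
  have hfl : IntegrableOn (fun x ↦ f x * exp (-l * x)) (Ioi 0) := by
    simpa using IntegrableOn.pow_mul_mul_exp_neg_mul hf 0 hl
  have hker : IntegrableOn (fun x : ℝ ↦ x ^ (α - 1) * exp (-l * x)) (Ioi 0) := by
    simpa using integrableOn_rpow_mul_exp_neg_mul_rpow (p := 1) (by linarith : -1 < α - 1)
      one_pos hl
  have hconv := integral_posConvolution hfl hker (ContinuousLinearMap.mul ℝ ℝ)
  have hGamma := integral_rpow_mul_exp_neg_mul_Ioi hα hl
  simp only [ContinuousLinearMap.mul_apply'] at hconv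
  simp only [← neg_mul] at hGamma
  rw [hGamma, one_div, inv_rpow hl.le, ← rpow_neg hl.le] at hconv
  rw [mul_comm, mul_comm (Gamma α), ← hconv]
  refine setIntegral_congr_fun measurableSet_Ioi fun x (hx : 0 < x) ↦ ?_
  rw [intervalIntegral.integral_of_le hx.le, integral_Ioc_eq_integral_Ioo, ← integral_mul_const]
  congr 1 with v
  rw [show -l * x = -l * v + -l * (x - v) by ring, exp_add]
  ring

/-- For `m = 2` and `α ∈ (0,2)`, with `ν = 1/(2−α)`, the Laplace transform of the
density solution equals `(1/Γ(ν)) ∫_0^∞ t^{ν−1} exp(−t − ν²λ^{1/ν}/t) dt`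
for every `λ > 0`. -/
theorem density_solution_m_two_laplace (α : ℝ) (hα : α ∈ Set.Ioo (0:ℝ) 2)
    (ν : ℝ) (hν : ν = 1 / (2 - α))
    (f : ℝ → ℝ) (hf : IsDensitySolution α 2 f) :
    ∀ l : ℝ, 0 < l →
      (∫ x in Set.Ioi (0:ℝ), Real.exp (-l * x) * f x) =
        (1 / Real.Gamma ν) *
          ∫ t in Set.Ioi (0:ℝ), t ^ (ν - 1) * Real.exp (-t - ν ^ 2 * l ^ (1 / ν) / t) := by
  obtain ⟨-, -, hone, heq⟩ := hf
  obtain ⟨hα0, hα2⟩ := hα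
  have hν0 : 0 < ν := hν ▸ one_div_pos.2 (by linarith)
  have hνα : 1 / ν - 2 = -α := by rw [hν]; field_simp; ring
  have hfi : IntegrableOn f (Ioi 0) := by
    by_contra h
    simp [integral_undef h] at hone
  set L : ℝ → ℝ := fun l ↦ ∫ x in Ioi (0:ℝ), f x * exp (-l * x)
  set L' : ℝ → ℝ := fun l ↦ -∫ x in Ioi (0:ℝ), x * f x * exp (-l * x)
  set M : ℝ → ℝ := fun l ↦ 1 / Gamma ν * expInvGamma ν (ν ^ 2 * l ^ (1 / ν))
  have hpos : ∀ᵐ x : ℝ ∂volume.restrict (Ioi 0), 0 < x := ae_restrict_mem measurableSet_Ioi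
  have hnonneg : ∀ᵐ x : ℝ ∂volume.restrict (Ioi 0), 0 ≤ x := hpos.mono fun _ h ↦ h.le
  have hint (n : ℕ) (s : ℝ) (hs : 0 < s) := IntegrableOn.pow_mul_mul_exp_neg_mul hfi n hs
  have hint0 : ∀ s : ℝ, 0 < s → IntegrableOn (fun x ↦ f x * exp (-s * x)) (Ioi 0) := by
    simpa using hint 0
  have hint1 : ∀ s : ℝ, 0 < s → IntegrableOn (fun x ↦ x * f x * exp (-s * x)) (Ioi 0) := by
    simpa using hint 1
  have hint2 : ∀ s : ℝ, 0 < s → IntegrableOn (fun x ↦ x * (x * f x) * exp (-s * x)) (Ioi 0) := by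
    simpa only [pow_two, mul_assoc] using hint 2
  have hL : ∀ l, 0 < l → HasDerivAt L (L' l) l := fun l hl ↦
    hasDerivAt_integral_mul_exp_neg_mul hnonneg hint0 hint1 hl
  have hL' : ∀ l, 0 < l → HasDerivAt L' (l ^ (-α) * L l) l := by
    intro l hl
    have h := (hasDerivAt_integral_mul_exp_neg_mul hnonneg hint1 hint2 hl).neg
    convert! h using 1
    rw [neg_neg]
    have hconv := integral_exp_neg_mul_fractional_integral hα0 hl hfi
    calc l ^ (-α) * L l = 1 / Gamma α * (Gamma α * l ^ (-α) * L l) := by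
          field_simp [(Gamma_pos_of_pos hα0).ne']
      _ = _ := by
          rw [← hconv, ← integral_const_mul]
          refine setIntegral_congr_fun measurableSet_Ioi fun x hx ↦ ?_
          have := heq x hx
          simp only [rpow_ofNat] at this
          rw [← mul_assoc, ← this]
          ring
  have hs0 : Tendsto (fun l : ℝ ↦ ν ^ 2 * l ^ (1 / ν)) (𝓝[>] 0) (𝓝[>] 0) := by
    refine tendsto_nhdsWithin_iff.2 ⟨?_, ?_⟩
    · have : ContinuousAt (fun l : ℝ ↦ ν ^ 2 * l ^ (1 / ν)) 0 :=
        (continuousAt_rpow_const 0 _ (.inr (by positivity))).const_mul _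
      simpa [zero_rpow (inv_pos.2 hν0).ne'] using this.tendsto.mono_left nhdsWithin_le_nhds
    · filter_upwards [self_mem_nhdsWithin] with l (hl : 0 < l)
      exact mem_Ioi.2 (by positivity)
  have hsT : Tendsto (fun l : ℝ ↦ ν ^ 2 * l ^ (1 / ν)) atTop atTop :=
    (tendsto_rpow_atTop (by positivity)).const_mul_atTop (by positivity)
  intro l hl
  have hdiff : L l - M l = 0 := by
    refine eq_zero_of_second_deriv_eq_mul (q := fun l ↦ l ^ (-α)) (y := fun l ↦ L l - M l)
      (y' := fun l ↦ L' l - 1 / Gamma ν *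
        (-expInvGamma (ν - 1) (ν ^ 2 * l ^ (1 / ν)) * (ν * l ^ (1 / ν - 1))))
      (fun x hx ↦ by positivity) (fun x hx ↦ ?_) (fun x hx ↦ ?_) ?_ ?_ hl
    · exact (hL x hx).sub ((hasDerivAt_expInvGamma_comp ν hν0 hx).const_mul _)
    · convert! (hL' x hx).sub ((hasDerivAt_deriv_expInvGamma_comp hν0 hx).const_mul _) using 1
      rw [hνα]
      ring
    · have h1 : Tendsto L (𝓝[>] 0) (𝓝 1) := by
        rw [← hone]
        exact tendsto_integral_mul_exp_neg_mul_nhdsGT_zero hfi (by fun_prop) hnonneg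
      have h2 : Tendsto M (𝓝[>] 0) (𝓝 (1 / Gamma ν * Gamma ν)) :=
        ((tendsto_expInvGamma_nhdsGT_zero hν0).comp hs0).const_mul _
      rw [one_div_mul_cancel (Gamma_pos_of_pos hν0).ne'] at h2
      simpa using h1.sub h2
    · have h1 : Tendsto L atTop (𝓝 0) :=
        tendsto_integral_mul_exp_neg_mul_atTop hfi (by fun_prop) hpos
      have h2 : Tendsto M atTop (𝓝 (1 / Gamma ν * 0)) :=
        ((tendsto_expInvGamma_atTop hν0).comp hsT).const_mul _
      simpa using h1.sub h2
  simp only [mul_comm (exp _) (f _)]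
  refine (sub_eq_zero.1 hdiff).trans ?_
  simp only [M, expInvGamma, mul_assoc, ← exp_add]
  congr! 5 with t
  ring
end
end
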